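/- arXiv:2604.02885 — 7 statements merged into one kernel-verified Lean document; each statement's English description precedes it below -/
import Mathlib

section
/- (Bang–Zsigmondy) Let a be an integer with |a| > 1. For every positive integer i there exists a prime r which is a primitive prime divisor of a^i − 1 (i.e., e(r,a) = i), except in the following cases: a = 2 and i ∈ {1, 6}; a = −2 and i ∈ {2, 3}; a = 3 and i = 1; a = −3 and i = 2. -/
/-- `e(r,a)`: for odd prime `r` coprime to `a`, the multiplicative order of `a` modulo `r`;
for `r = 2` and odd `a`, it is `1` if `a ≡ 1 (mod 4)` and `2` if `a ≡ 3 (mod 4)`. -/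
noncomputable def eOrd (r : ℕ) (a : ℤ) : ℕ :=
  if r = 2 then (if a % 4 = 1 then 1 else 2) else orderOf (a : ZMod r)

/-- `k_i(a)`: the product, over all primitive prime divisors `r` of `a^i - 1`
(i.e. primes `r` with `e(r,a) = i`), of the `r`-part of `a^i - 1`. -/
noncomputable def kPart (i : ℕ) (a : ℤ) : ℕ :=
  ∏ r ∈ (a ^ i - 1).natAbs.primeFactors.filter (fun r => eOrd r a = i),
    r ^ (a ^ i - 1).natAbs.factorization r

open Polynomial

theorem Polynomial.abs_eval_cyclotomic_bounds {n : ℕ} (hn : 0 < n) {x : ℤ} (hx : 1 ≤ |x|) :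
    (|x| - 1) ^ n.totient ≤ |(cyclotomic n ℤ).eval x| ∧
      |(cyclotomic n ℤ).eval x| ≤ (|x| + 1) ^ n.totient := by
  have hζ := Complex.isPrimitiveRoot_exp n hn.ne'
  have hnorm : ‖(cyclotomic n ℂ).eval (x : ℂ)‖ = ((|(cyclotomic n ℤ).eval x| : ℤ) : ℝ) := by
    rw [← map_cyclotomic_int n ℂ, eval_intCast_map, eq_intCast, Int.cast_id, Complex.norm_intCast,
      Int.cast_abs]
  have hprod : ‖(cyclotomic n ℂ).eval (x : ℂ)‖ = ∏ ζ ∈ primitiveRoots n ℂ, ‖(x : ℂ) - ζ‖ := by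
    simp [cyclotomic_eq_prod_X_sub_primitiveRoots hζ, eval_prod]
  have hroot : ∀ ζ ∈ primitiveRoots n ℂ, ‖ζ‖ = 1 := fun ζ h =>
    ((mem_primitiveRoots hn).mp h).norm'_eq_one hn.ne'
  have hxn : ‖(x : ℂ)‖ = |(x : ℝ)| := Complex.norm_intCast x
  have hx' : (1 : ℝ) ≤ |(x : ℝ)| := by exact_mod_cast hx
  have hcard : ∀ c : ℝ, ∏ _ζ ∈ primitiveRoots n ℂ, c = c ^ n.totient := fun c => by
    rw [Finset.prod_const, Complex.card_primitiveRoots]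
  constructor
  · have : (|(x : ℝ)| - 1) ^ n.totient ≤ ((|(cyclotomic n ℤ).eval x| : ℤ) : ℝ) := by
      rw [← hnorm, hprod, ← hcard]
      refine Finset.prod_le_prod (fun _ _ => by linarith) fun ζ h => ?_
      simpa [hroot ζ h, hxn] using norm_sub_norm_le (x : ℂ) ζ
    exact_mod_cast this
  · have : ((|(cyclotomic n ℤ).eval x| : ℤ) : ℝ) ≤ (|(x : ℝ)| + 1) ^ n.totient := by
      rw [← hnorm, hprod, ← hcard]
      refine Finset.prod_le_prod (fun _ _ => norm_nonneg _) fun ζ h => ?_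
      simpa [hroot ζ h, hxn] using norm_sub_le (x : ℂ) ζ
    exact_mod_cast this

theorem Polynomial.lt_abs_eval_cyclotomic_mul_prime_of_dvd {p n : ℕ} (hp : p.Prime) (hn : 0 < n)
    (hpn : p ∣ n) {a : ℤ} (ha : 2 ≤ |a|) : (p : ℤ) < |(cyclotomic (n * p) ℤ).eval a| := by
  have hpow : (p : ℤ) + 1 < |a ^ p| := by
    have h1 : p + 1 < 2 ^ p := by
      have h2 := hp.two_le
      clear hpn hp
      induction p, h2 using Nat.le_induction with
      | base => norm_num
      | succ k _ ih => rw [pow_succ]; lia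
    have h2 : (2 : ℤ) ^ p ≤ |a| ^ p := pow_le_pow_left₀ (by norm_num) ha p
    rw [abs_pow]
    have h3 : (p : ℤ) + 1 < 2 ^ p := by exact_mod_cast h1
    linarith
  rw [← cyclotomic_expand_eq_cyclotomic hp hpn, expand_eval]
  have h1 := (abs_eval_cyclotomic_bounds hn (x := a ^ p) (by lia)).1
  have h2 : |a ^ p| - 1 ≤ (|a ^ p| - 1) ^ n.totient :=
    le_self_pow₀ (by lia) (Nat.totient_pos.mpr hn).ne'
  linarith

theorem Polynomial.le_abs_eval_cyclotomic_mul_prime_of_not_dvd {p n : ℕ} (hp : p.Prime)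
    (hn : 0 < n) (hpn : ¬p ∣ n) {a c : ℤ} (ha : 2 ≤ |a|) (hc : 1 ≤ c)
    (h : c * (|a| + 1) ≤ |a| ^ p - 1) : c ≤ |(cyclotomic (n * p) ℤ).eval a| := by
  have hmul : (cyclotomic n ℤ).eval (a ^ p) =
      (cyclotomic (n * p) ℤ).eval a * (cyclotomic n ℤ).eval a := by
    rw [← expand_eval, cyclotomic_expand_eq_cyclotomic_mul hp hpn, eval_mul]
  have h1 := (abs_eval_cyclotomic_bounds hn (x := a ^ p)
    (by rw [abs_pow]; exact one_le_pow₀ (by lia))).1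
  have h2 := (abs_eval_cyclotomic_bounds hn (x := a) (by lia)).2
  rw [hmul, abs_mul, abs_pow] at h1
  have h3 : (c * (|a| + 1)) ^ n.totient ≤ (|a| ^ p - 1) ^ n.totient :=
    pow_le_pow_left₀ (by positivity) h _
  rw [mul_pow] at h3
  have h4 : c ≤ c ^ n.totient := le_self_pow₀ hc (Nat.totient_pos.mpr hn).ne'
  have h5 := mul_le_mul_of_nonneg_left h2 (abs_nonneg ((cyclotomic (n * p) ℤ).eval a))
  have h6 : 0 < (|a| + 1) ^ n.totient := by positivity
  exact h4.trans (le_of_mul_le_mul_right (h3.trans (h1.trans h5)) h6)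

theorem Polynomial.orderOf_eq_of_dvd_eval_cyclotomic {p k m : ℕ} (hp : p.Prime) (hm : ¬p ∣ m)
    {a : ℤ} (h : (p : ℤ) ∣ (cyclotomic (p ^ k * m) ℤ).eval a) : orderOf (a : ZMod p) = m := by
  have : Fact p.Prime := ⟨hp⟩
  have : NeZero (m : ZMod p) := ⟨by rwa [Ne, ZMod.natCast_eq_zero_iff]⟩
  have hroot : (cyclotomic (p ^ k * m) (ZMod p)).IsRoot (a : ZMod p) := by
    rw [IsRoot.def, ← map_cyclotomic_int, eval_intCast_map, eq_intCast, Int.cast_id,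
      ZMod.intCast_zmod_eq_zero_iff_dvd]
    exact h
  exact ((isRoot_cyclotomic_prime_pow_mul_iff_of_charP).mp hroot).eq_orderOf.symm

theorem ZMod.orderOf_lt_of_prime {p : ℕ} (hp : p.Prime) {x : ZMod p} (hx : 0 < orderOf x) :
    orderOf x < p := by
  have : Fact p.Prime := ⟨hp⟩
  have hx0 : x ≠ 0 := by
    rintro rfl
    simp at hx
  have := Nat.le_of_dvd (Nat.sub_pos_of_lt hp.one_lt) (ZMod.orderOf_dvd_card_sub_one hx0)
  have := hp.pos
  lia

theorem Polynomial.prime_sq_not_dvd_eval_cyclotomic {p n : ℕ} (hp : p.Prime) (hn : 0 < n)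
    (h : Odd p ∨ Even n) (a : ℤ) : ¬(p : ℤ) ^ 2 ∣ (cyclotomic (n * p) ℤ).eval a := by
  intro hsq
  have : Fact p.Prime := ⟨hp⟩
  have hpZ : Prime (p : ℤ) := Nat.prime_iff_prime_int.mp hp
  have hgeom : (cyclotomic (n * p) ℤ).eval a ∣ ∑ j ∈ Finset.range p, (a ^ n) ^ j := by
    have hdvd : (X ^ n - 1) * cyclotomic (n * p) ℤ ∣
        (X ^ n - 1) * ∑ j ∈ Finset.range p, ((X : ℤ[X]) ^ n) ^ j := by
      rw [mul_geom_sum, ← pow_mul]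
      refine X_pow_sub_one_mul_cyclotomic_dvd_X_pow_sub_one_of_dvd ℤ ?_
      exact Nat.mem_properDivisors.mpr ⟨dvd_mul_right _ _, lt_mul_of_one_lt_right hn hp.one_lt⟩
    have hne : (X : ℤ[X]) ^ n - 1 ≠ 0 := X_pow_sub_C_ne_zero hn 1
    simpa [eval_finsetSum] using eval_dvd (x := a) ((mul_dvd_mul_iff_left hne).mp hdvd)
  have hpow : (p : ℤ) ∣ a ^ n - 1 := by
    have h1 : (p : ℤ) ∣ (a ^ n) ^ p - 1 := by
      rw [← mul_geom_sum]
      exact ((dvd_pow_self _ two_ne_zero).trans (hsq.trans hgeom)).mul_left _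
    rw [← ZMod.intCast_zmod_eq_zero_iff_dvd] at h1 ⊢
    push_cast at h1 ⊢
    rwa [ZMod.pow_card] at h1
  have hpa : ¬(p : ℤ) ∣ a ^ n := fun h => hpZ.not_dvd_one ((dvd_sub_right h).mp hpow)
  obtain hodd | rfl : Odd p ∨ p = 2 := hp.eq_two_or_odd'.symm
  · have h1 := emultiplicity_geom_sum₂_eq_one hpZ hodd hpow hpa
    simp only [one_pow, mul_one] at h1
    have h2 := le_emultiplicity_of_pow_dvd (hsq.trans hgeom)
    rw [h1] at h2
    exact absurd h2 (by decide)
  · obtain ⟨k, rfl⟩ := h.resolve_left (by decide)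
    have hodd : Odd (a ^ k) := by
      rw [← Int.not_even_iff_odd, even_iff_two_dvd]
      exact fun h => hpa (by rw [pow_add]; exact h.mul_right _)
    have h1 := Int.sq_mod_four_eq_one_of_odd hodd
    have h2 := hsq.trans hgeom
    simp only [Finset.sum_range_succ, Finset.sum_range_zero] at h2
    rw [← two_mul, mul_comm 2 k, pow_mul] at h2
    push_cast at h2
    lia

theorem Int.succ_mul_abs_add_one_le_abs_pow_sub_one {p : ℕ} (hp : 5 ≤ p) {a : ℤ} (ha : 2 ≤ |a|) :
    ((p : ℤ) + 1) * (|a| + 1) ≤ |a| ^ p - 1 := by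
  generalize |a| = b at ha
  induction p, hp using Nat.le_induction with
  | base =>
    have h2 : 4 ≤ b ^ 2 := by nlinarith
    have h4 : 16 ≤ b ^ 4 := by nlinarith
    push_cast
    nlinarith
  | succ k hk ih =>
    rw [pow_succ]
    push_cast
    have hk' : (5 : ℤ) ≤ k := by exact_mod_cast hk
    have h1 : 0 ≤ b ^ k := by positivity
    nlinarith

theorem exists_prime_orderOf_intCast_eq {a : ℤ} (ha : 2 ≤ |a|) {i : ℕ} (hi : 3 ≤ i)
    (h2 : ¬(a = 2 ∧ i = 6)) (h2' : ¬(a = -2 ∧ i = 3)) :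
    ∃ r : ℕ, r.Prime ∧ orderOf (a : ZMod r) = i := by
  by_contra! H
  have key : ∀ q : ℕ, q.Prime → (q : ℤ) ∣ (cyclotomic i ℤ).eval a →
      q ∣ i ∧ ∀ l : ℕ, l.Prime → l ∣ i → l ≤ q := by
    intro q hq hdvd
    obtain ⟨k, m, hm, rfl⟩ := Nat.exists_eq_pow_mul_and_not_dvd (by lia : i ≠ 0) q hq.ne_one
    have hord := orderOf_eq_of_dvd_eval_cyclotomic hq hm hdvd
    have hm0 : 0 < m := Nat.pos_of_ne_zero fun h => hm (h ▸ dvd_zero q)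
    have hmq : m < q := hord ▸ ZMod.orderOf_lt_of_prime hq (hord ▸ hm0)
    have hk : k ≠ 0 := by
      rintro rfl
      exact H q hq (by simpa using hord)
    refine ⟨(dvd_pow_self q hk).mul_right m, fun l hl hdl => ?_⟩
    obtain h | h := hl.dvd_mul.mp hdl
    · exact Nat.le_of_dvd hq.pos (hl.dvd_of_dvd_pow h)
    · exact (Nat.le_of_dvd hm0 h).trans hmq.le
  obtain ⟨p, hpi, hmax⟩ := i.primeFactors.exists_max_image id
    (Nat.nonempty_primeFactors.mpr (by lia))
  have hp := Nat.prime_of_mem_primeFactors hpi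
  obtain ⟨n, rfl⟩ : ∃ n, i = n * p := exists_eq_mul_left_of_dvd (Nat.dvd_of_mem_primeFactors hpi)
  have hn : 0 < n := Nat.pos_of_ne_zero (by rintro rfl; simp at hi)
  have hmax' : ∀ l : ℕ, l.Prime → l ∣ n * p → l ≤ p := fun l hl hdl =>
    hmax l (Nat.mem_primeFactors.mpr ⟨hl, hdl, by lia⟩)
  have hpar : Odd p ∨ 2 ∣ n := by
    refine hp.eq_two_or_odd'.symm.imp_right ?_
    rintro rfl
    have hq := Nat.minFac_prime (n := n) (by lia)
    have : n.minFac = 2 :=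
      (hmax' _ hq ((Nat.minFac_dvd n).mul_right 2)).antisymm hq.two_le
    exact this ▸ Nat.minFac_dvd n
  have hΦ : |(cyclotomic (n * p) ℤ).eval a| = 1 ∨ |(cyclotomic (n * p) ℤ).eval a| = p := by
    rw [Int.abs_eq_natAbs]
    norm_cast
    have hsq := prime_sq_not_dvd_eval_cyclotomic hp hn (hpar.imp_right even_iff_two_dvd.mpr) a
    have hne : ((cyclotomic (n * p) ℤ).eval a).natAbs ≠ 0 := by
      intro h
      exact hsq (by simp [Int.natAbs_eq_zero.mp h])
    have hpow := Nat.eq_prime_pow_of_unique_prime_dvd hne (p := p) fun {q} hq hdq => by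
      obtain ⟨h, h'⟩ := key q hq (Int.natCast_dvd.mpr hdq)
      exact (hmax' q hq h).antisymm (h' p hp (dvd_mul_left p n))
    generalize ((cyclotomic (n * p) ℤ).eval a).natAbs.primeFactorsList.length = j at hpow
    have hj : j < 2 := by
      by_contra! hj
      refine hsq ?_
      rw [← Nat.cast_pow, Int.natCast_dvd, hpow]
      exact pow_dvd_pow p hj
    interval_cases j
    · exact .inl (by simpa using hpow)
    · exact .inr (by simpa using hpow)
  have hp2 := hp.two_le
  by_cases hpn : p ∣ n
  · have := lt_abs_eval_cyclotomic_mul_prime_of_dvd hp hn hpn ha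
    lia
  have hp_ne : p ≠ 2 := by
    rintro rfl
    exact hpn (hpar.resolve_left (by decide))
  have hp_ne' : p ≠ 4 := by
    rintro rfl
    exact absurd hp (by decide)
  obtain rfl | hp5 : p = 3 ∨ 5 ≤ p := by lia
  swap
  · have := le_abs_eval_cyclotomic_mul_prime_of_not_dvd hp hn hpn ha (by lia)
      (Int.succ_mul_abs_add_one_le_abs_pow_sub_one hp5 ha)
    lia
  obtain ha2 | ha3 : |a| = 2 ∨ 3 ≤ |a| := by lia
  swap
  · have := le_abs_eval_cyclotomic_mul_prime_of_not_dvd hp hn hpn ha (c := 4) (by lia)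
      (by nlinarith [mul_self_nonneg (|a| - 3)])
    lia
  have hlow := le_abs_eval_cyclotomic_mul_prime_of_not_dvd hp hn hpn ha (c := 2) (by lia)
    (by rw [ha2]; norm_num)
  have hord : orderOf (a : ZMod 3) = n :=
    orderOf_eq_of_dvd_eval_cyclotomic (k := 1) hp hpn (by rw [pow_one, mul_comm, ← dvd_abs]; lia)
  have hn3 : n < 3 := hord ▸ ZMod.orderOf_lt_of_prime hp (hord ▸ hn)
  obtain rfl | rfl := (abs_eq two_pos.le).mp ha2 <;> interval_cases n <;>
    simp_all [cyclotomic_three, cyclotomic_six]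

theorem Int.exists_odd_prime_dvd_or_four_dvd {x : ℤ} (h : 2 < x.natAbs) :
    (∃ r : ℕ, r.Prime ∧ r ≠ 2 ∧ (r : ℤ) ∣ x) ∨ 4 ∣ x := by
  obtain h4 | ⟨r, hr, hrx, hodd⟩ :=
    Nat.four_dvd_or_exists_odd_prime_and_dvd_of_two_lt h
  · exact .inr (Int.natCast_dvd.mpr h4)
  · exact .inl ⟨r, hr, by rintro rfl; exact absurd hodd (by decide), Int.natCast_dvd.mpr hrx⟩

/-- Bang–Zsigmondy: for `|a| > 1` and `i ≥ 1` there is a primitive prime divisor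
of `a^i - 1`, with the listed exceptions. -/
theorem bang_zsigmondy (a : ℤ) (ha : 1 < a.natAbs) (i : ℕ) (hi : 0 < i)
    (h1 : ¬(a = 2 ∧ (i = 1 ∨ i = 6)))
    (h2 : ¬(a = -2 ∧ (i = 2 ∨ i = 3)))
    (h3 : ¬(a = 3 ∧ i = 1))
    (h4 : ¬(a = -3 ∧ i = 2)) :
    ∃ r : ℕ, r.Prime ∧ eOrd r a = i := by
  obtain rfl | rfl | hi3 : i = 1 ∨ i = 2 ∨ 3 ≤ i := by lia
  · obtain ⟨r, hr, hr2, hdvd⟩ | hdvd :=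
      Int.exists_odd_prime_dvd_or_four_dvd (x := a - 1) (by lia)
    · refine ⟨r, hr, ?_⟩
      rw [eOrd, if_neg hr2, orderOf_eq_one_iff]
      rw [← ZMod.intCast_zmod_eq_zero_iff_dvd] at hdvd
      push_cast at hdvd
      exact sub_eq_zero.mp hdvd
    · exact ⟨2, Nat.prime_two, by rw [eOrd, if_pos rfl, if_pos (by lia)]⟩
  · obtain ⟨r, hr, hr2, hdvd⟩ | hdvd :=
      Int.exists_odd_prime_dvd_or_four_dvd (x := a + 1) (by lia)
    · refine ⟨r, hr, ?_⟩
      have : Fact (2 < r) := ⟨lt_of_le_of_ne hr.two_le hr2.symm⟩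
      rw [← ZMod.intCast_zmod_eq_zero_iff_dvd] at hdvd
      push_cast at hdvd
      rw [eOrd, if_neg hr2, eq_neg_of_add_eq_zero_left hdvd]
      exact orderOf_eq_prime (by simp) ZMod.neg_one_ne_one
    · exact ⟨2, Nat.prime_two, by rw [eOrd, if_pos rfl, if_neg (by lia)]⟩
  · obtain ⟨r, hr, hord⟩ := exists_prime_orderOf_intCast_eq (a := a)
      (by rw [Int.abs_eq_natAbs]; lia) hi3 (by lia) (by lia)
    have hr2 : r ≠ 2 := by
      rintro rfl
      have := ZMod.orderOf_lt_of_prime hr (hord ▸ hi)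
      lia
    exact ⟨r, hr, by rw [eOrd, if_neg hr2, hord]⟩
end

section
/- Let a and i be integers with |a| > 1 and i ≥ 3. Let r be the largest prime divisor of i and let l = i/(i)_r be the part of i coprime to r (where (i)_r is the largest power of r dividing i). Then k_i(a) = Φ_i(a)/gcd(r, Φ_l(a)). Furthermore, if l does not divide r − 1, then gcd(r, Φ_l(a)) = 1. -/
open Polynomial in
theorem prime_dvd_eval_cyclotomic_iff {p : ℕ} (hp : p.Prime) (a : ℤ) (k : ℕ) {m : ℕ}
    (hm : ¬ p ∣ m) :
    (p : ℤ) ∣ (cyclotomic (p ^ k * m) ℤ).eval a ↔ IsPrimitiveRoot (a : ZMod p) m := by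
  have := Fact.mk hp
  have : NeZero (m : ZMod p) := ⟨by rwa [Ne, ZMod.natCast_eq_zero_iff]⟩
  rw [← isRoot_cyclotomic_prime_pow_mul_iff_of_charP (p := p) (k := k), IsRoot.def,
    ← ZMod.intCast_zmod_eq_zero_iff_dvd]
  have h := cyclotomic.eval_apply a (p ^ k * m) (Int.castRingHom (ZMod p))
  simp only [eq_intCast] at h
  rw [h]

open Polynomial in
theorem prime_dvd_eval_cyclotomic_iff_of_not_dvd {p : ℕ} (hp : p.Prime) (a : ℤ) {n : ℕ}
    (hn : ¬ p ∣ n) : (p : ℤ) ∣ (cyclotomic n ℤ).eval a ↔ IsPrimitiveRoot (a : ZMod p) n := by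
  simpa using prime_dvd_eval_cyclotomic_iff hp a 0 hn

theorem IsPrimitiveRoot.dvd_prime_sub_one {p n : ℕ} (hp : p.Prime) {x : ZMod p} (hn : n ≠ 0)
    (h : IsPrimitiveRoot x n) : n ∣ p - 1 := by
  have := Fact.mk hp
  have hx : x ≠ 0 := h.isUnit hn |>.ne_zero
  exact h.dvd_of_pow_eq_one _ (ZMod.pow_card_sub_one_eq_one hx)

theorem factorization_prod_pow_apply {S : Finset ℕ} (hS : ∀ q ∈ S, q.Prime) (f : ℕ → ℕ) (p : ℕ) :
    (∏ q ∈ S, q ^ f q).factorization p = if p ∈ S then f p else 0 := by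
  rw [Nat.factorization_prod fun q hq => pow_ne_zero _ (hS q hq).ne_zero, Finsupp.finsetSum_apply,
    Finset.sum_congr rfl fun q hq => by rw [(hS q hq).factorization_pow, Finsupp.single_apply]]
  simp

theorem eOrd_eq_iff {p : ℕ} (hp : p.Prime) (a : ℤ) {i : ℕ} (hi : 3 ≤ i) :
    eOrd p a = i ↔ IsPrimitiveRoot (a : ZMod p) i := by
  rw [IsPrimitiveRoot.iff_orderOf, eOrd]
  by_cases h2 : p = 2
  · rw [if_pos h2]
    subst h2
    refine ⟨fun h => by split_ifs at h <;> omega, fun h => ?_⟩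
    have := Nat.le_of_dvd one_pos
      ((IsPrimitiveRoot.iff_orderOf.2 h).dvd_prime_sub_one hp (by omega))
    omega
  · rw [if_neg h2]

open Polynomial in
theorem factorization_pow_sub_one_eq_cyclotomic {p : ℕ} (hp : p.Prime) {a : ℤ} {i : ℕ}
    (hi : i ≠ 0) (hpi : ¬ p ∣ i) (ha : a ^ i - 1 ≠ 0) (h : IsPrimitiveRoot (a : ZMod p) i) :
    (a ^ i - 1).natAbs.factorization p = ((cyclotomic i ℤ).eval a).natAbs.factorization p := by
  have hprod : (cyclotomic i ℤ).eval a * ∏ d ∈ i.properDivisors, (cyclotomic d ℤ).eval a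
      = a ^ i - 1 := by
    have := congrArg (eval a) (prod_cyclotomic_eq_X_pow_sub_one (Nat.pos_of_ne_zero hi) ℤ)
    rw [← Nat.cons_self_properDivisors hi, Finset.prod_cons] at this
    simpa [eval_prod] using this
  have hQ : ¬ (p : ℤ) ∣ ∏ d ∈ i.properDivisors, (cyclotomic d ℤ).eval a := by
    rw [(Nat.prime_iff_prime_int.1 hp).dvd_finsetProd_iff]
    rintro ⟨d, hd, hdvd⟩
    rw [Nat.mem_properDivisors] at hd
    rw [prime_dvd_eval_cyclotomic_iff_of_not_dvd hp a fun h' => hpi (h'.trans hd.1)] at hdvd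
    exact hd.2.ne (hdvd.unique h)
  rw [← hprod] at ha ⊢
  rw [Int.natAbs_mul, Nat.factorization_mul (by simpa using left_ne_zero_of_mul ha)
    (by simpa using right_ne_zero_of_mul ha), Finsupp.add_apply,
    Nat.factorization_eq_zero_of_not_dvd (n := Int.natAbs (∏ _ ∈ _, _))
      (by rwa [← Int.natCast_dvd]), add_zero]

open Polynomial in
theorem not_prime_sq_dvd_eval_cyclotomic {r : ℕ} (hr : r.Prime) {a : ℤ} {i : ℕ} (hri : r ∣ i)
    (hl : r = 2 → 4 ∣ i) (ha : a ^ i - 1 ≠ 0)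
    (hb : (r : ℤ) ∣ a ^ (i / r) - 1) :
    ¬ (r : ℤ) ^ 2 ∣ (cyclotomic i ℤ).eval a := by
  intro hsq
  obtain ⟨j, rfl⟩ := hri
  rw [Nat.mul_div_cancel_left _ hr.pos] at hb
  have hj : j ≠ 0 := by rintro rfl; simp at ha
  have hdvd : (a ^ j - 1) * (cyclotomic (r * j) ℤ).eval a ∣ a ^ (r * j) - 1 := by
    have := X_pow_sub_one_mul_cyclotomic_dvd_X_pow_sub_one_of_dvd ℤ
      (d := j) (n := r * j) (Nat.mem_properDivisors.2 ⟨Dvd.intro_left r rfl,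
        (lt_mul_iff_one_lt_left (Nat.pos_of_ne_zero hj)).2 hr.one_lt⟩)
    simpa using eval_dvd (x := a) this
  have h1 : (a ^ j - 1) * (r : ℤ) ^ 2 ∣ (a ^ j) ^ r - 1 := by
    rw [← pow_mul, mul_comm j]
    exact (mul_dvd_mul_left _ hsq).trans hdvd
  have ha' : a ^ j - 1 ≠ 0 := fun h => ha <| by
    rw [mul_comm, pow_mul, sub_eq_zero.1 h, one_pow, sub_self]
  have hsq : (r : ℤ) ^ 2 ∣ ∑ k ∈ Finset.range r, (a ^ j) ^ k :=
    Int.dvd_of_mul_dvd_mul_left ha' (by rwa [mul_geom_sum])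
  rcases eq_or_ne r 2 with rfl | h2
  · obtain ⟨m, rfl⟩ : 2 ∣ j := by have := hl rfl; omega
    have hodd : Odd (a ^ m) := by
      rw [pow_mul'] at hb
      rw [← Int.not_even_iff_odd]
      intro he
      have := (he.two_dvd).trans (dvd_pow_self _ two_ne_zero)
      push_cast at hb
      omega
    have := Int.sq_mod_four_eq_one_of_odd hodd
    rw [← pow_mul'] at this
    simp only [Finset.sum_range_succ, Finset.sum_range_zero] at hsq
    push_cast at hsq
    norm_num at hsq
    omega
  · have hnd : ¬ (r : ℤ) ∣ a ^ j := fun h => hr.not_dvd_one <| by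
      have := dvd_sub h hb
      rw [sub_sub_cancel] at this
      exact_mod_cast this
    have hlte := Int.emultiplicity_pow_sub_pow hr (hr.odd_of_ne_two h2) (x := a ^ j) (y := 1)
      hb hnd r
    have hfin : FiniteMultiplicity (r : ℤ) (a ^ j - 1) :=
      Int.finiteMultiplicity_iff.2 ⟨by simpa using hr.ne_one, ha'⟩
    have hself : emultiplicity r r = 1 := by
      simpa using Nat.Prime.emultiplicity_self hr
    rw [one_pow, hself, ← mul_geom_sum, emultiplicity_mul (Nat.prime_iff_prime_int.1 hr),
      hfin.emultiplicity_eq_multiplicity] at hlte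
    have h2le := le_emultiplicity_of_pow_dvd hsq
    rw [WithTop.add_left_cancel (ENat.natCast_ne_top _) hlte] at h2le
    norm_num at h2le

/-- `k_i(a) = Φ_i(a) / gcd(r, Φ_l(a))`, where `r` is the largest prime divisor of `i`
and `l` is the `r'`-part of `i`; moreover the gcd is `1` when `l ∤ r - 1`. -/
theorem kPart_eq_cyclotomic_div (a : ℤ) (ha : 1 < a.natAbs) (i : ℕ) (hi : 3 ≤ i)
    (r : ℕ) (hr : r.Prime) (hri : r ∣ i)
    (hrmax : ∀ s : ℕ, s.Prime → s ∣ i → s ≤ r)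
    (l : ℕ) (hl : l = i / r ^ i.factorization r) :
    (kPart i a : ℤ) * (Int.gcd (r : ℤ) ((Polynomial.cyclotomic l ℤ).eval a) : ℤ) =
        (Polynomial.cyclotomic i ℤ).eval a ∧
      (¬ l ∣ r - 1 → Int.gcd (r : ℤ) ((Polynomial.cyclotomic l ℤ).eval a) = 1) := by
  classical
  have hi0 : i ≠ 0 := by omega
  have hl_not : ¬ r ∣ l := hl ▸ Nat.not_dvd_ordCompl hr hi0
  have hil : i = r ^ i.factorization r * l := by rw [hl, Nat.ordProj_mul_ordCompl_eq_self]
  set k := i.factorization r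
  have hk0 : k ≠ 0 := (hr.factorization_pos_of_dvd hi0 hri).ne'
  have hl0 : l ≠ 0 := by rintro rfl; simp at hl_not
  have hgcd_dvd := Nat.dvd_prime hr |>.1 (Int.gcd_dvd_natAbs_left (r : ℤ)
    ((Polynomial.cyclotomic l ℤ).eval a))
  have hgcd : Int.gcd (r : ℤ) ((Polynomial.cyclotomic l ℤ).eval a) =
      if IsPrimitiveRoot (a : ZMod r) l then r else 1 := by
    rw [← prime_dvd_eval_cyclotomic_iff_of_not_dvd hr a hl_not]
    split_ifs with h
    · simpa using Int.gcd_eq_natAbs_left h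
    · exact hgcd_dvd.resolve_right fun h' => h <| by
        have := Int.gcd_dvd_right (r : ℤ) ((Polynomial.cyclotomic l ℤ).eval a)
        rwa [h'] at this
  refine ⟨?_, fun h => ?_⟩
  · have hpos : 0 < (Polynomial.cyclotomic i ℤ).eval a := Polynomial.cyclotomic_pos (by omega) a
    have ha0 : a ^ i - 1 ≠ 0 := fun h => by
      have := congrArg Int.natAbs (sub_eq_zero.1 h)
      rw [Int.natAbs_pow, Int.natAbs_one, Nat.pow_eq_one] at this
      omega
    have hS : ∀ q ∈ (a ^ i - 1).natAbs.primeFactors.filter (fun q => eOrd q a = i), q.Prime :=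
      fun q hq => Nat.prime_of_mem_primeFactors (Finset.mem_of_mem_filter q hq)
    have hkp : kPart i a ≠ 0 :=
      Finset.prod_ne_zero_iff.2 fun q hq => pow_ne_zero _ (hS q hq).ne_zero
    have hg0 : Int.gcd (r : ℤ) ((Polynomial.cyclotomic l ℤ).eval a) ≠ 0 := by
      rw [hgcd]; split_ifs; exacts [hr.ne_zero, one_ne_zero]
    rw [← Int.natAbs_of_nonneg hpos.le]
    norm_cast
    refine Nat.eq_of_factorization_eq (mul_ne_zero hkp hg0) (by simpa using hpos.ne') fun p => ?_
    by_cases hp : p.Prime; swap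
    · simp [Nat.factorization_eq_zero_of_not_prime _ hp]
    rw [Nat.factorization_mul hkp hg0, Finsupp.add_apply, kPart, factorization_prod_pow_apply hS,
      hgcd]
    simp only [Finset.mem_filter, eOrd_eq_iff hp a hi]
    by_cases hprim : IsPrimitiveRoot (a : ZMod p) i
    · have hpi : ¬ p ∣ i := fun h => by
        have := Nat.le_of_dvd (Nat.sub_pos_of_lt hp.one_lt) (hprim.dvd_prime_sub_one hp hi0)
        have := Nat.le_of_dvd (Nat.pos_of_ne_zero hi0) h
        have := hp.pos
        omega
      have hpN : p ∈ (a ^ i - 1).natAbs.primeFactors := by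
        refine Nat.mem_primeFactors.2 ⟨hp, ?_, by simpa using ha0⟩
        rw [← Int.natCast_dvd, ← ZMod.intCast_zmod_eq_zero_iff_dvd]
        simp [hprim.pow_eq_one]
      have hpr : p ≠ r := fun h => hpi (h ▸ hri)
      rw [if_pos ⟨hpN, hprim⟩, factorization_pow_sub_one_eq_cyclotomic hp hi0 hpi ha0 hprim,
        add_eq_left, Nat.factorization_eq_zero_of_not_dvd]
      split_ifs
      · rwa [Nat.prime_dvd_prime_iff_eq hp hr]
      · exact hp.not_dvd_one
    rw [if_neg fun h => hprim h.2, zero_add]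
    by_cases hpr : p = r
    · subst hpr
      have hiff := prime_dvd_eval_cyclotomic_iff hp a k hl_not
      rw [← hil] at hiff
      split_ifs with h
      · rw [hp.factorization_self]
        have hdvd := hiff.2 h
        have hsq := not_prime_sq_dvd_eval_cyclotomic hp hri (a := a) ?_ ha0 ?_
        · have h1 := (hp.dvd_iff_one_le_factorization (by simpa using hpos.ne')).1
            (Int.natCast_dvd.1 hdvd)
          have h2 := mt (hp.pow_dvd_iff_le_factorization (k := 2)
            (n := (Polynomial.cyclotomic i ℤ |>.eval a).natAbs) (by simpa using hpos.ne')).2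
            (fun h => hsq (by exact_mod_cast Int.natCast_dvd.2 h))
          omega
        · rintro rfl
          have hl1 : l = 1 := by
            have := h.dvd_prime_sub_one hp hl0
            simpa using this
          rw [hl1, mul_one] at hil
          have : 2 ≤ k := by
            by_contra!
            interval_cases k <;> omega
          rw [hil]
          exact pow_dvd_pow 2 this
        · rw [← ZMod.intCast_zmod_eq_zero_iff_dvd]
          obtain ⟨n, hn⟩ : l ∣ i / p := by
            obtain ⟨k', hk'⟩ := Nat.exists_eq_succ_of_ne_zero hk0
            refine ⟨p ^ k', ?_⟩
            conv_lhs => rw [hil, hk']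
            rw [pow_succ', mul_assoc, Nat.mul_div_cancel_left _ hp.pos, mul_comm]
          simp [hn, pow_mul, h.pow_eq_one]
      · rw [Nat.factorization_one, Finsupp.zero_apply, Nat.factorization_eq_zero_of_not_dvd]
        rwa [← Int.natCast_dvd, hiff]
    · rw [Nat.factorization_eq_zero_of_not_dvd, Nat.factorization_eq_zero_of_not_dvd]
      · rw [← Int.natCast_dvd]
        intro hdvd
        have hip : i = p ^ i.factorization p * (i / p ^ i.factorization p) :=
          (Nat.ordProj_mul_ordCompl_eq_self i p).symm
        have hnot := Nat.not_dvd_ordCompl hp hi0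
        rw [hip, prime_dvd_eval_cyclotomic_iff hp a _ hnot] at hdvd
        have hm0 : i / p ^ i.factorization p ≠ 0 := by
          intro h; simp [h] at hnot
        by_cases hpi : p ∣ i
        · have hrm : r ∣ i / p ^ i.factorization p := by
            have hri' := hri
            rw [hip, hr.dvd_mul] at hri'
            exact hri'.resolve_left fun h =>
              hpr ((Nat.prime_dvd_prime_iff_eq hr hp).1 (hr.dvd_of_dvd_pow h)).symm
          have h1 := Nat.le_of_dvd (Nat.sub_pos_of_lt hp.one_lt)
            (hrm.trans (hdvd.dvd_prime_sub_one hp hm0))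
          have h2 := hrmax p hp hpi
          have h3 := hp.pos
          omega
        · rw [Nat.factorization_eq_zero_of_not_dvd hpi, pow_zero, Nat.div_one] at hdvd
          exact hprim hdvd
      · split_ifs
        · rwa [Nat.prime_dvd_prime_iff_eq hp hr]
        · exact hp.not_dvd_one
  · rw [hgcd, if_neg fun h' => h (h'.dvd_prime_sub_one hr hl0)]
end

section
/- For every prime power q, one has k_12(q) ≥ (q^4 + 1)/2 and k_8(q) ≥ (q^4 + 1)/2. -/
/-- A divisor of `a ^ i - 1` all of whose prime factors are primitive is at most `k_i(a)`. -/
theorem le_kPart_of_dvd {i D : ℕ} {a : ℤ} (hN : a ^ i - 1 ≠ 0) (hD : (D : ℤ) ∣ a ^ i - 1)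
    (he : ∀ r, r.Prime → r ∣ D → eOrd r a = i) : D ≤ kPart i a := by
  have hN' : (a ^ i - 1).natAbs ≠ 0 := Int.natAbs_ne_zero.mpr hN
  have hD' : D ∣ (a ^ i - 1).natAbs := Int.natCast_dvd.mp hD
  have hD0 : D ≠ 0 := ne_zero_of_dvd_ne_zero hN' hD'
  have hpos : ∀ r ∈ (a ^ i - 1).natAbs.primeFactors.filter (fun r => eOrd r a = i),
      1 ≤ r ^ (a ^ i - 1).natAbs.factorization r := fun r hr =>
    Nat.one_le_pow _ _ (Nat.prime_of_mem_primeFactors (Finset.mem_filter.mp hr).1).pos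
  calc D = ∏ r ∈ D.primeFactors, r ^ D.factorization r :=
        (Nat.prod_factorization_pow_eq_self hD0).symm
    _ ≤ ∏ r ∈ D.primeFactors, r ^ (a ^ i - 1).natAbs.factorization r :=
        Finset.prod_le_prod' fun r hr => Nat.pow_le_pow_right
          (Nat.prime_of_mem_primeFactors hr).pos
          ((Nat.factorization_le_iff_dvd hD0 hN').mpr hD' r)
    _ ≤ kPart i a := by
        refine Finset.prod_le_prod_of_subset_of_one_le' (fun r hr => ?_) fun r hr _ => hpos r hr
        have hr' := Nat.mem_primeFactors.mp hr
        exact Finset.mem_filter.mpr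
          ⟨Nat.mem_primeFactors.mpr ⟨hr'.1, hr'.2.1.trans hD', hN'⟩, he r hr'.1 hr'.2.1⟩

theorem eOrd_eq_eight {r : ℕ} (hr : r.Prime) (hr2 : r ≠ 2) {a : ℤ} (h : (r : ℤ) ∣ a ^ 4 + 1) :
    eOrd r a = 8 := by
  rw [eOrd, if_neg hr2]
  have : Fact r.Prime := ⟨hr⟩
  have : Fact (2 < r) := ⟨lt_of_le_of_ne hr.two_le hr2.symm⟩
  have h4 : (a : ZMod r) ^ 4 = -1 := by
    rw [← ZMod.intCast_zmod_eq_zero_iff_dvd] at h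
    push_cast at h
    linear_combination h
  refine orderOf_eq_prime_pow (p := 2) (n := 2) ?_ ?_
  · norm_num [h4, ZMod.neg_one_ne_one]
  · norm_num
    linear_combination ((a : ZMod r) ^ 4 - 1) * h4

theorem not_three_dvd_cyclotomic_twelve (a : ℤ) : ¬ (3 : ℤ) ∣ a ^ 4 - a ^ 2 + 1 := by
  intro h
  have h' := (ZMod.intCast_zmod_eq_zero_iff_dvd (a ^ 4 - a ^ 2 + 1) 3).mpr (by exact_mod_cast h)
  push_cast at h'
  generalize (a : ZMod 3) = x at h'
  revert x
  decide

theorem not_two_dvd_cyclotomic_twelve (a : ℤ) : ¬ (2 : ℤ) ∣ a ^ 4 - a ^ 2 + 1 := by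
  intro h
  have h' := (ZMod.intCast_zmod_eq_zero_iff_dvd (a ^ 4 - a ^ 2 + 1) 2).mpr (by exact_mod_cast h)
  push_cast at h'
  generalize (a : ZMod 2) = x at h'
  revert x
  decide

theorem eOrd_eq_twelve {r : ℕ} (hr : r.Prime) {a : ℤ} (h : (r : ℤ) ∣ a ^ 4 - a ^ 2 + 1) :
    eOrd r a = 12 := by
  have hr2 : r ≠ 2 := by
    rintro rfl
    exact not_two_dvd_cyclotomic_twelve a h
  have hr3 : r ≠ 3 := by
    rintro rfl
    exact not_three_dvd_cyclotomic_twelve a h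
  rw [eOrd, if_neg hr2]
  have : Fact r.Prime := ⟨hr⟩
  have : Fact (2 < r) := ⟨lt_of_le_of_ne hr.two_le hr2.symm⟩
  rw [← ZMod.intCast_zmod_eq_zero_iff_dvd] at h
  push_cast at h
  generalize (a : ZMod r) = x at h
  refine orderOf_eq_of_pow_and_pow_div_prime (by norm_num) ?_ fun p hp hpd => ?_
  · linear_combination (x ^ 2 + 1) * (x ^ 6 - 1) * h
  · have hp' : p = 2 ∨ p = 3 := by
      have : p ∣ 2 ^ 2 * 3 := hpd
      rcases hp.dvd_mul.mp this with h | h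
      · exact .inl ((Nat.prime_dvd_prime_iff_eq hp Nat.prime_two).mp (hp.dvd_of_dvd_pow h))
      · exact .inr ((Nat.prime_dvd_prime_iff_eq hp Nat.prime_three).mp h)
    rcases hp' with rfl | rfl
    · norm_num
      intro h6
      exact ZMod.neg_one_ne_one (n := r) (by linear_combination h6 - (x ^ 2 + 1) * h)
    · norm_num
      intro h4
      have h3 : ((3 : ℕ) : ZMod r) = 0 := by
        push_cast
        linear_combination (x ^ 2 + 2) * h - (x ^ 2 + 1) * h4
      exact hr3 ((Nat.prime_dvd_prime_iff_eq hr Nat.prime_three).mp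
        ((ZMod.natCast_eq_zero_iff 3 r).mp h3))

/-- For every prime power `q`, `k_12(q) ≥ (q^4+1)/2` and `k_8(q) ≥ (q^4+1)/2`. -/
theorem kPart_twelve_eight_bound (q : ℕ) (hq : IsPrimePow q) :
    ((q : ℚ) ^ 4 + 1) / 2 ≤ (kPart 12 (q : ℤ) : ℚ) ∧
      ((q : ℚ) ^ 4 + 1) / 2 ≤ (kPart 8 (q : ℤ) : ℚ) := by
  have hq2 : (2 : ℤ) ≤ q := by exact_mod_cast hq.two_le
  have hN : ∀ i ≠ 0, (q : ℤ) ^ i - 1 ≠ 0 := fun i hi =>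
    (sub_pos.mpr (one_lt_pow₀ (by linarith) hi)).ne'
  constructor
  · obtain ⟨D, hD⟩ := Int.eq_ofNat_of_zero_le
      (show (0 : ℤ) ≤ (q : ℤ) ^ 4 - (q : ℤ) ^ 2 + 1 by nlinarith [sq_nonneg ((q : ℤ) ^ 2 - 1)])
    have hle : D ≤ kPart 12 q := by
      refine le_kPart_of_dvd (hN 12 (by norm_num)) ?_ fun r hr hrD => eOrd_eq_twelve hr ?_
      · exact ⟨((q : ℤ) ^ 2 + 1) * ((q : ℤ) ^ 6 - 1), by rw [← hD]; ring⟩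
      · rw [hD]
        exact_mod_cast hrD
    have hD' : (q : ℚ) ^ 4 - (q : ℚ) ^ 2 + 1 = D := by exact_mod_cast hD
    have hle' : (D : ℚ) ≤ kPart 12 q := by exact_mod_cast hle
    nlinarith [sq_nonneg ((q : ℚ) ^ 2 - 1)]
  · obtain ⟨D, c, hD, hodd, hc⟩ : ∃ D c : ℕ, q ^ 4 + 1 = D * c ∧ ¬ 2 ∣ D ∧ c ≤ 2 := by
      rcases Nat.even_or_odd' q with ⟨m, rfl | rfl⟩
      · refine ⟨(2 * m) ^ 4 + 1, 1, by ring, ?_, by norm_num⟩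
        ring_nf
        omega
      · refine ⟨8 * m ^ 4 + 16 * m ^ 3 + 12 * m ^ 2 + 4 * m + 1, 2, by ring, ?_, le_rfl⟩
        omega
    have hDq : (q : ℤ) ^ 4 + 1 = D * c := by exact_mod_cast hD
    have hle : D ≤ kPart 8 q := by
      refine le_kPart_of_dvd (hN 8 (by norm_num)) ?_ fun r hr hrD => eOrd_eq_eight hr ?_ ?_
      · exact ⟨c * ((q : ℤ) ^ 4 - 1), by linear_combination ((q : ℤ) ^ 4 - 1) * hDq⟩
      · rintro rfl
        exact hodd hrD
      · rw [hDq]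
        exact (Int.natCast_dvd_natCast.mpr hrD).mul_right _
    have hle2 : q ^ 4 + 1 ≤ kPart 8 q * 2 := hD ▸ Nat.mul_le_mul hle hc
    have hle' : (q : ℚ) ^ 4 + 1 ≤ kPart 8 q * 2 := by exact_mod_cast hle2
    linarith
end

section
/- Let q be a prime power. Then k_5(q)·k_10(q) > q^8/5 + 1. Moreover, if ε ∈ {+1, −1} and εq ≠ −4, then k_5(εq) > q^4/6 + 1. -/
theorem dvd_kPart {i N : ℕ} {a : ℤ} (h : a ^ i ≠ 1) (hN : (N : ℤ) ∣ a ^ i - 1)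
    (hp : ∀ r : ℕ, r.Prime → r ∣ N → eOrd r a = i) : N ∣ kPart i a := by
  have hM : (a ^ i - 1).natAbs ≠ 0 := Int.natAbs_ne_zero.mpr (sub_ne_zero.mpr h)
  have hd : N ∣ (a ^ i - 1).natAbs := Int.natCast_dvd.mp hN
  have hN0 : N ≠ 0 := ne_zero_of_dvd_ne_zero hM hd
  have hprod : N = ∏ r ∈ N.primeFactors, r ^ N.factorization r :=
    (Nat.prod_factorization_pow_eq_self hN0).symm
  rw [hprod]
  refine (Finset.prod_dvd_prod_of_dvd _ (fun r => r ^ (a ^ i - 1).natAbs.factorization r)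
    fun r _ => pow_dvd_pow r ?_).trans (Finset.prod_dvd_prod_of_subset _ _ _ ?_)
  · exact (Nat.factorization_le_iff_dvd hN0 hM).mpr hd r
  · intro r hr
    exact Finset.mem_filter.mpr ⟨Nat.primeFactors_mono hd hM hr,
      hp r (Nat.prime_of_mem_primeFactors hr) (Nat.dvd_of_mem_primeFactors hr)⟩

theorem kPart_pos (i : ℕ) (a : ℤ) : 0 < kPart i a :=
  Finset.prod_pos fun _ hr =>
    pow_pos (Nat.prime_of_mem_primeFactors (Finset.mem_filter.mp hr).1).pos _

theorem orderOf_eq_five {r : ℕ} [Fact r.Prime] (hr : r ≠ 5) {b : ZMod r}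
    (h : b ^ 4 + b ^ 3 + b ^ 2 + b + 1 = 0) : orderOf b = 5 := by
  have : Fact (Nat.Prime 5) := ⟨by norm_num⟩
  refine orderOf_eq_prime (by linear_combination (b - 1) * h) ?_
  rintro rfl
  have h5 : ((5 : ℕ) : ZMod r) = 0 := by push_cast; linear_combination h
  rw [ZMod.natCast_eq_zero_iff] at h5
  exact hr ((Nat.prime_dvd_prime_iff_eq Fact.out (by norm_num)).mp h5)

theorem orderOf_eq_ten {r : ℕ} [Fact r.Prime] (hr : r ≠ 5) (hr2 : r ≠ 2) {b : ZMod r}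
    (h : (-b) ^ 4 + (-b) ^ 3 + (-b) ^ 2 + -b + 1 = 0) : orderOf b = 10 := by
  have : Fact (2 < r) := ⟨lt_of_le_of_ne (Fact.out : r.Prime).two_le hr2.symm⟩
  have hb5 : b ^ 5 = -1 := by linear_combination (b + 1) * h
  have hne : -b ≠ 1 := by
    intro hb
    have := orderOf_eq_five hr h
    simp [hb] at this
  refine orderOf_eq_of_pow_and_pow_div_prime (by norm_num)
    (by linear_combination (b ^ 5 - 1) * hb5) ?_
  intro p hp hpd
  have hp' : p = 2 ∨ p = 5 := by
    have : p ∣ 2 * 5 := hpd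
    rcases hp.dvd_mul.mp this with h2 | h5
    · exact Or.inl ((Nat.prime_dvd_prime_iff_eq hp (by norm_num)).mp h2)
    · exact Or.inr ((Nat.prime_dvd_prime_iff_eq hp (by norm_num)).mp h5)
  rcases hp' with rfl | rfl
  · change b ^ 5 ≠ 1
    rw [hb5]
    exact ZMod.neg_one_ne_one
  · change b ^ 2 ≠ 1
    intro h2
    exact hne (by linear_combination (b ^ 3 + b) * h2 - hb5)

theorem cyclotomic_five_pos (a : ℤ) : 0 < a ^ 4 + a ^ 3 + a ^ 2 + a + 1 := by
  nlinarith [sq_nonneg (2 * a ^ 2 + a), sq_nonneg (3 * a + 2)]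

theorem exists_cyclotomic_five_eq_mul (a : ℤ) : ∃ N : ℕ, ¬ 5 ∣ N ∧
    (N : ℤ) * (if a % 5 = 1 then 5 else 1) = a ^ 4 + a ^ 3 + a ^ 2 + a + 1 := by
  have hpos := cyclotomic_five_pos a
  split_ifs with h
  · obtain ⟨k, rfl⟩ : ∃ k, a = 5 * k + 1 := ⟨a / 5, by omega⟩
    have hm : (0 : ℤ) ≤ 1 + 5 * (2 * k + 10 * k ^ 2 + 25 * k ^ 3 + 25 * k ^ 4) := by nlinarith
    obtain ⟨N, hN⟩ := Int.eq_ofNat_of_zero_le hm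
    refine ⟨N, by omega, ?_⟩
    rw [← hN]
    ring
  · obtain ⟨N, hN⟩ := Int.eq_ofNat_of_zero_le hpos.le
    refine ⟨N, fun hd => h ?_, by rw [hN, mul_one]⟩
    have hd' : (a ^ 4 + a ^ 3 + a ^ 2 + a + 1) % 5 = 0 := by omega
    have h5 : a % 5 = 0 ∨ a % 5 = 1 ∨ a % 5 = 2 ∨ a % 5 = 3 ∨ a % 5 = 4 := by omega
    rcases h5 with h5 | h5 | h5 | h5 | h5 <;>
      simp [pow_succ, Int.add_emod, Int.mul_emod, h5] at hd' ⊢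

theorem not_two_dvd_cyclotomic_five (a : ℤ) : ¬ (2 : ℤ) ∣ a ^ 4 + a ^ 3 + a ^ 2 + a + 1 := by
  intro hd
  have hd' := Int.emod_eq_zero_of_dvd hd
  rcases Int.emod_two_eq_zero_or_one a with h | h <;>
    simp [pow_succ, Int.add_emod, Int.mul_emod, h] at hd'

theorem cyclotomic_five_le_kPart_five {a : ℤ} (ha : a ≠ 1) :
    a ^ 4 + a ^ 3 + a ^ 2 + a + 1 ≤ kPart 5 a * (if a % 5 = 1 then 5 else 1) := by
  obtain ⟨N, h5, hN⟩ := exists_cyclotomic_five_eq_mul a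
  have hd : (N : ℤ) ∣ a ^ 4 + a ^ 3 + a ^ 2 + a + 1 := ⟨_, hN.symm⟩
  have hfac : a ^ 5 - 1 = (a ^ 4 + a ^ 3 + a ^ 2 + a + 1) * (a - 1) := by ring
  have hdvd : N ∣ kPart 5 a := by
    refine dvd_kPart ?_ (hfac ▸ hd.mul_right _) fun r hr hrN => ?_
    · exact sub_ne_zero.mp
        (hfac ▸ mul_ne_zero (cyclotomic_five_pos a).ne' (sub_ne_zero.mpr ha))
    · have : Fact r.Prime := ⟨hr⟩
      have hrd := (Int.natCast_dvd_natCast.mpr hrN).trans hd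
      have hr2 : r ≠ 2 := by
        rintro rfl
        exact not_two_dvd_cyclotomic_five a hrd
      rw [eOrd, if_neg hr2]
      refine orderOf_eq_five (by rintro rfl; exact h5 hrN) ?_
      exact_mod_cast (ZMod.intCast_zmod_eq_zero_iff_dvd _ r).mpr hrd
  rw [← hN]
  have hle : (N : ℤ) ≤ kPart 5 a := by exact_mod_cast Nat.le_of_dvd (kPart_pos 5 a) hdvd
  exact mul_le_mul_of_nonneg_right hle (by split_ifs <;> norm_num)

theorem cyclotomic_ten_le_kPart_ten {a : ℤ} (ha : a ^ 10 ≠ 1) :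
    (-a) ^ 4 + (-a) ^ 3 + (-a) ^ 2 + -a + 1 ≤ kPart 10 a * (if -a % 5 = 1 then 5 else 1) := by
  obtain ⟨N, h5, hN⟩ := exists_cyclotomic_five_eq_mul (-a)
  have hd : (N : ℤ) ∣ (-a) ^ 4 + (-a) ^ 3 + (-a) ^ 2 + -a + 1 := ⟨_, hN.symm⟩
  have hfac : a ^ 10 - 1 =
      ((-a) ^ 4 + (-a) ^ 3 + (-a) ^ 2 + -a + 1) * ((a + 1) * (a ^ 5 - 1)) := by ring
  have hdvd : N ∣ kPart 10 a := by
    refine dvd_kPart ha (hfac ▸ hd.mul_right _) fun r hr hrN => ?_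
    have : Fact r.Prime := ⟨hr⟩
    have hrd := (Int.natCast_dvd_natCast.mpr hrN).trans hd
    have hr2 : r ≠ 2 := by
      rintro rfl
      exact not_two_dvd_cyclotomic_five (-a) hrd
    rw [eOrd, if_neg hr2]
    refine orderOf_eq_ten (by rintro rfl; exact h5 hrN) hr2 ?_
    exact_mod_cast (ZMod.intCast_zmod_eq_zero_iff_dvd _ r).mpr hrd
  rw [← hN]
  have hle : (N : ℤ) ≤ kPart 10 a := by exact_mod_cast Nat.le_of_dvd (kPart_pos 10 a) hdvd
  exact mul_le_mul_of_nonneg_right hle (by split_ifs <;> norm_num)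

theorem lt_kPart_five_mul_kPart_ten {a : ℤ} (ha : 2 ≤ a) :
    a ^ 8 + 5 < 5 * ((kPart 5 a : ℤ) * kPart 10 a) := by
  have h1 := cyclotomic_five_le_kPart_five (a := a) (by omega)
  have h2 := cyclotomic_ten_le_kPart_ten (a := a) (one_lt_pow₀ (by omega) (by norm_num)).ne'
  have hmul := mul_le_mul h1 h2 (cyclotomic_five_pos (-a)).le
    ((cyclotomic_five_pos a).le.trans h1)
  have hK : (0 : ℤ) ≤ (kPart 5 a : ℤ) * kPart 10 a := by positivity
  have hg : ((kPart 5 a : ℤ) * (if a % 5 = 1 then 5 else 1)) *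
      (kPart 10 a * (if -a % 5 = 1 then 5 else 1)) ≤ 5 * ((kPart 5 a : ℤ) * kPart 10 a) := by
    split_ifs
    · omega
    all_goals nlinarith
  have h2a : (2 : ℤ) ^ 2 ≤ a ^ 2 := pow_le_pow_left₀ (by norm_num) ha 2
  have h4a : (2 : ℤ) ^ 4 ≤ a ^ 4 := pow_le_pow_left₀ (by norm_num) ha 4
  have h6a : (2 : ℤ) ^ 6 ≤ a ^ 6 := pow_le_pow_left₀ (by norm_num) ha 6
  have hexp : (a ^ 4 + a ^ 3 + a ^ 2 + a + 1) * ((-a) ^ 4 + (-a) ^ 3 + (-a) ^ 2 + -a + 1) =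
      a ^ 8 + a ^ 6 + a ^ 4 + a ^ 2 + 1 := by ring
  linarith

theorem lt_kPart_five {a : ℤ} (ha : 2 ≤ a ∨ a ≤ -2) (ha4 : a ≠ -4) :
    a ^ 4 + 6 < 6 * (kPart 5 a : ℤ) := by
  have h := cyclotomic_five_le_kPart_five (a := a) (by omega)
  split_ifs at h with hm
  · rcases ha with ha | ha
    · obtain ⟨b, rfl⟩ : ∃ b, a = b + 2 := ⟨a - 2, by ring⟩
      have hb : 0 ≤ b := by omega
      have : 0 < (b + 2) ^ 4 + 6 * (b + 2) ^ 3 + 6 * (b + 2) ^ 2 + 6 * (b + 2) - 24 := by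
        ring_nf
        positivity
      linarith
    · obtain ⟨b, rfl⟩ : ∃ b, a = -(b + 9) := ⟨-a - 9, by ring⟩
      have hb : 0 ≤ b := by omega
      have : 0 < (b + 9) ^ 4 - 6 * (b + 9) ^ 3 + 6 * (b + 9) ^ 2 - 6 * (b + 9) - 24 := by
        ring_nf
        positivity
      linarith
  · rcases ha with ha | ha
    · have : 0 < a ^ 4 := by positivity
      have : 0 < a ^ 3 := by positivity
      have : 0 < a ^ 2 := by positivity
      linarith
    · obtain ⟨b, rfl⟩ : ∃ b, a = -(b + 2) := ⟨-a - 2, by ring⟩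
      have hb : 0 ≤ b := by omega
      have : 0 < 5 * (b + 2) ^ 4 - 6 * (b + 2) ^ 3 + 6 * (b + 2) ^ 2 - 6 * (b + 2) := by
        ring_nf
        positivity
      linarith

/-- `k_5(q)·k_10(q) > q^8/5 + 1`, and `k_5(εq) > q^4/6 + 1` whenever `εq ≠ -4`. -/
theorem kPart_five_ten_bound (q : ℕ) (hq : IsPrimePow q) :
    ((q : ℚ) ^ 8 / 5 + 1 < (kPart 5 (q : ℤ) : ℚ) * (kPart 10 (q : ℤ) : ℚ)) ∧
      (∀ ε : ℤ, (ε = 1 ∨ ε = -1) → ε * (q : ℤ) ≠ -4 →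
        (q : ℚ) ^ 4 / 6 + 1 < (kPart 5 (ε * q) : ℚ)) := by
  have hq2 : 2 ≤ q := hq.two_le
  constructor
  · have h := lt_kPart_five_mul_kPart_ten (a := q) (by exact_mod_cast hq2)
    have h' : (q : ℚ) ^ 8 + 5 < 5 * ((kPart 5 (q : ℤ) : ℚ) * (kPart 10 (q : ℤ) : ℚ)) := by
      exact_mod_cast h
    linarith
  · intro ε hε h4
    have h := lt_kPart_five (a := ε * q) (by rcases hε with rfl | rfl <;> omega) h4
    have hpow : (ε * (q : ℤ)) ^ 4 = (q : ℤ) ^ 4 := by rcases hε with rfl | rfl <;> ring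
    rw [hpow] at h
    have h' : (q : ℚ) ^ 4 + 6 < 6 * (kPart 5 (ε * q) : ℚ) := by exact_mod_cast h
    linarith
end

section
/- Suppose a and b are integers such that |a| and |b| are prime powers, |a| ≠ |b|, and k_5(a) = k_5(b). Then gcd(5, a − 1) ≠ gcd(5, b − 1) and k_5(−a) ≠ k_5(−b). -/
/-- The fifth cyclotomic polynomial, as an integer-valued function. -/
def phiFive (a : ℤ) : ℤ := a ^ 4 + a ^ 3 + a ^ 2 + a + 1

lemma sub_one_mul_phiFive (a : ℤ) : a ^ 5 - 1 = (a - 1) * phiFive a := by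
  unfold phiFive; ring

lemma phiFive_pos (a : ℤ) : 0 < phiFive a := by
  unfold phiFive
  nlinarith [sq_nonneg (2 * a ^ 2 + a), sq_nonneg (a + 1), sq_nonneg a]

lemma not_two_dvd_phiFive (a : ℤ) : ¬ (2 : ℤ) ∣ phiFive a := by
  have h : phiFive a = (a * (a + 1)) * (a ^ 2 + 1) + 1 := by unfold phiFive; ring
  have h2 : (2 : ℤ) ∣ (a * (a + 1)) * (a ^ 2 + 1) :=
    (Int.even_mul_succ_self a).two_dvd.mul_right _
  omega

lemma phiFive_modEq (a k : ℤ) (h : a - 1 = 5 * k) : ∃ m, phiFive a = 5 + 25 * m := by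
  obtain rfl : a = 5 * k + 1 := by linarith
  exact ⟨25 * k ^ 4 + 25 * k ^ 3 + 10 * k ^ 2 + 2 * k, by unfold phiFive; ring⟩

lemma dvd_five_of_dvd (a d : ℤ) (h : d ∣ a - 1) (h' : d ∣ phiFive a) : d ∣ 5 := by
  have : (5 : ℤ) = phiFive a - (a - 1) * (a ^ 3 + 2 * a ^ 2 + 3 * a + 4) := by
    unfold phiFive; ring
  rw [this]
  exact dvd_sub h' (h.mul_right _)

lemma eOrd_eq_five_iff {r : ℕ} (hr : r.Prime) (a : ℤ) :
    ((r : ℤ) ∣ a ^ 5 - 1 ∧ eOrd r a = 5) ↔ ((r : ℤ) ∣ phiFive a ∧ ¬ (r : ℤ) ∣ a - 1) := by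
  have hp : Prime (r : ℤ) := Nat.prime_iff_prime_int.mp hr
  rcases eq_or_ne r 2 with rfl | h2
  · have : eOrd 2 a ≠ 5 := by unfold eOrd; split_ifs <;> simp_all
    have := not_two_dvd_phiFive a
    simp_all
  · have h5 : ((a : ZMod r) ^ 5 = 1) ↔ (r : ℤ) ∣ a ^ 5 - 1 := by
      rw [← CharP.intCast_eq_zero_iff (ZMod r) r]; push_cast; rw [sub_eq_zero]
    have h1 : ((a : ZMod r) = 1) ↔ (r : ℤ) ∣ a - 1 := by
      rw [← CharP.intCast_eq_zero_iff (ZMod r) r]; push_cast; rw [sub_eq_zero]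
    have : Fact (Nat.Prime 5) := ⟨by norm_num⟩
    rw [eOrd, if_neg h2, orderOf_eq_prime_iff, h5, Ne, h1, sub_one_mul_phiFive, hp.dvd_mul]
    tauto

lemma gcd_five_eq (a : ℤ) : Int.gcd 5 a = if (5 : ℤ) ∣ a then 5 else 1 := by
  split_ifs with h
  · exact Int.gcd_eq_natAbs_left h
  · have h5 : Prime (5 : ℤ) := Nat.prime_iff_prime_int.mp (by norm_num)
    exact Int.isCoprime_iff_gcd_eq_one.mp (h5.coprime_iff_not_dvd.mpr h)

lemma kPart_five_mul_gcd (a : ℤ) (ha : a ≠ 1) :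
    (kPart 5 a : ℤ) * Int.gcd 5 (a - 1) = phiFive a := by
  have hD : (a - 1).natAbs ≠ 0 := by omega
  have hpos := phiFive_pos a
  have hP : (phiFive a).natAbs ≠ 0 := by omega
  have hN : (a ^ 5 - 1).natAbs = (a - 1).natAbs * (phiFive a).natAbs := by
    rw [sub_one_mul_phiFive, Int.natAbs_mul]
  have hfilter : (a ^ 5 - 1).natAbs.primeFactors.filter (fun r => eOrd r a = 5) =
      (phiFive a).natAbs.primeFactors.filter (fun r : ℕ => ¬ (r : ℤ) ∣ a - 1) := by
    ext r
    have h0 : (a ^ 5 - 1).natAbs ≠ 0 := by rw [hN]; exact mul_ne_zero hD hP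
    simp only [Finset.mem_filter, Nat.mem_primeFactors_of_ne_zero h0,
      Nat.mem_primeFactors_of_ne_zero hP, ← Int.natCast_dvd, and_assoc]
    exact and_congr_right fun hr => eOrd_eq_five_iff hr a
  have hk : kPart 5 a = ∏ r ∈ (phiFive a).natAbs.primeFactors.filter
      (fun r : ℕ => ¬ (r : ℤ) ∣ a - 1), r ^ (phiFive a).natAbs.factorization r := by
    rw [kPart, hfilter]
    refine Finset.prod_congr rfl fun r hr => ?_
    rw [hN, Nat.factorization_mul hD hP, Finsupp.add_apply,
      Nat.factorization_eq_zero_of_not_dvd, zero_add]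
    rw [← Int.natCast_dvd]
    exact (Finset.mem_filter.mp hr).2
  have hg : ∏ r ∈ (phiFive a).natAbs.primeFactors.filter (fun r : ℕ => (r : ℤ) ∣ a - 1),
      r ^ (phiFive a).natAbs.factorization r = Int.gcd 5 (a - 1) := by
    have hsub : ∀ r ∈ (phiFive a).natAbs.primeFactors.filter
        (fun r : ℕ => (r : ℤ) ∣ a - 1), r = 5 := by
      intro r hr
      simp only [Finset.mem_filter, Nat.mem_primeFactors_of_ne_zero hP, ← Int.natCast_dvd] at hr
      have := dvd_five_of_dvd a r hr.2 hr.1.2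
      exact (Nat.prime_dvd_prime_iff_eq hr.1.1 (by norm_num)).mp (by exact_mod_cast this)
    by_cases h5 : (5 : ℤ) ∣ a - 1
    · obtain ⟨k, hk⟩ := h5
      obtain ⟨m, hm⟩ := phiFive_modEq a k hk
      have hset : (phiFive a).natAbs.primeFactors.filter (fun r : ℕ => (r : ℤ) ∣ a - 1) = {5} := by
        refine Finset.eq_singleton_iff_unique_mem.mpr ⟨?_, hsub⟩
        simp only [Finset.mem_filter, Nat.mem_primeFactors_of_ne_zero hP]
        refine ⟨⟨by norm_num, by omega⟩, by rw [hk]; simp⟩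
      have hv : (phiFive a).natAbs.factorization 5 = 1 := by
        refine le_antisymm ?_ ?_
        · by_contra! hlt
          have : 5 ^ 2 ∣ (phiFive a).natAbs :=
            ((Nat.Prime.pow_dvd_iff_le_factorization (by norm_num) hP).mpr hlt)
          omega
        · exact (Nat.Prime.dvd_iff_one_le_factorization (by norm_num) hP).mp (by omega)
      rw [hset, Finset.prod_singleton, hv, hk]
      simp
    · have hset : (phiFive a).natAbs.primeFactors.filter (fun r : ℕ => (r : ℤ) ∣ a - 1) = ∅ := by
        refine Finset.eq_empty_of_forall_notMem fun r hr => h5 ?_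
        have := (Finset.mem_filter.mp hr).2
        rwa [hsub r hr] at this
      rw [hset, Finset.prod_empty, gcd_five_eq, if_neg h5]
  have hprod := Finset.prod_filter_mul_prod_filter_not (phiFive a).natAbs.primeFactors
    (fun r : ℕ => (r : ℤ) ∣ a - 1) (fun r => r ^ (phiFive a).natAbs.factorization r)
  have hself : ∏ r ∈ (phiFive a).natAbs.primeFactors, r ^ (phiFive a).natAbs.factorization r =
      (phiFive a).natAbs := Nat.prod_factorization_pow_eq_self hP
  rw [hg, ← hk, hself] at hprod
  rw [mul_comm, ← Nat.cast_mul, hprod, Int.natAbs_of_nonneg hpos.le]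

lemma phiFive_lt_phiFive {m n : ℤ} (hm : 0 ≤ m) (hmn : m < n) : phiFive m < phiFive n := by
  unfold phiFive
  gcongr

lemma phiFive_neg_lt {n : ℤ} (hn : 0 < n) : phiFive (-n) < phiFive n := by
  unfold phiFive
  nlinarith [pow_pos hn 3]

lemma lt_phiFive_neg {n : ℤ} (hn : 2 ≤ n) : phiFive (n - 1) < phiFive (-n) := by
  have : phiFive (-n) - phiFive (n - 1) = n * (2 * n - 1) * (n - 1) := by
    unfold phiFive; ring
  have : 0 < n * (2 * n - 1) * (n - 1) :=
    mul_pos (mul_pos (by linarith) (by linarith)) (by linarith)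
  linarith

lemma phiFive_lt_of_abs_lt {a b : ℤ} (ha : 2 ≤ |a|) (hab : |a| < |b|) :
    phiFive a < phiFive b := by
  have hle : phiFive a ≤ phiFive |a| := by
    rcases abs_choice a with h | h
    · rw [h]
    · have := phiFive_neg_lt (n := |a|) (by linarith)
      rw [show -|a| = a by linarith] at this
      exact this.le
  have hle' : phiFive |a| ≤ phiFive (|b| - 1) := by
    rcases (show |a| ≤ |b| - 1 by linarith).eq_or_lt with h | h
    · rw [h]
    · exact (phiFive_lt_phiFive (abs_nonneg a) h).le
  have hlt : phiFive (|b| - 1) < phiFive b := by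
    rcases abs_choice b with h | h
    · rw [h]
      exact phiFive_lt_phiFive (by linarith) (by linarith)
    · have := lt_phiFive_neg (n := |b|) (by linarith)
      rwa [show -|b| = b by linarith] at this
  linarith

lemma phiFive_ne {a b : ℤ} (ha : 2 ≤ |a|) (hb : 2 ≤ |b|) (hab : |a| ≠ |b|) :
    phiFive a ≠ phiFive b := by
  rcases hab.lt_or_gt with h | h
  · exact (phiFive_lt_of_abs_lt ha h).ne
  · exact (phiFive_lt_of_abs_lt hb h).ne'

lemma phiFive_lt_five_mul {a : ℤ} (ha : a ≠ 1) : phiFive a < 5 * phiFive (-a) := by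
  have h : 5 * phiFive (-a) - phiFive a = 2 * ((a - 1) ^ 2 * (2 * a ^ 2 + a + 2)) := by
    unfold phiFive; ring
  have : 0 < (a - 1) ^ 2 * (2 * a ^ 2 + a + 2) :=
    mul_pos (by have := sub_ne_zero.mpr ha; positivity) (by nlinarith [sq_nonneg (a + 1)])
  linarith

lemma gcd_ne_of_kPart_five_eq {a b : ℤ} (ha : 2 ≤ |a|) (hb : 2 ≤ |b|) (hab : |a| ≠ |b|)
    (h : kPart 5 a = kPart 5 b) : Int.gcd 5 (a - 1) ≠ Int.gcd 5 (b - 1) := by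
  intro hg
  refine phiFive_ne ha hb hab ?_
  rw [← kPart_five_mul_gcd a (by rintro rfl; simp at ha),
    ← kPart_five_mul_gcd b (by rintro rfl; simp at hb), h, hg]

lemma kPart_five_neg_ne_of_dvd {a b : ℤ} (ha : 2 ≤ |a|) (hb : 2 ≤ |b|) (hab : |a| ≠ |b|)
    (h : kPart 5 a = kPart 5 b) (hda : (5 : ℤ) ∣ a - 1) : kPart 5 (-a) ≠ kPart 5 (-b) := by
  intro hneg
  have hg := gcd_ne_of_kPart_five_eq ha hb hab h
  have hg' := gcd_ne_of_kPart_five_eq (a := -a) (b := -b) (by simpa) (by simpa) (by simpa) hneg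
  have ha1 : a ≠ 1 := by rintro rfl; simp at ha
  have hb1 : b ≠ 1 := by rintro rfl; simp at hb
  have ha2 : -a ≠ 1 := fun h => by simp [show a = -1 by omega] at ha
  have hb2 : -b ≠ 1 := fun h => by simp [show b = -1 by omega] at hb
  have h1 := kPart_five_mul_gcd a ha1
  have h2 := kPart_five_mul_gcd b hb1
  have h3 := kPart_five_mul_gcd (-a) ha2
  have h4 := kPart_five_mul_gcd (-b) hb2
  have hda' : ¬ (5 : ℤ) ∣ -a - 1 := by omega
  simp only [gcd_five_eq, if_pos hda, if_neg hda'] at *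
  have hdb : ¬ (5 : ℤ) ∣ b - 1 := by intro hd; simp [hd] at hg
  have hdb' : (5 : ℤ) ∣ -b - 1 := by by_contra hd; simp [hd] at hg'
  simp only [if_neg hdb, if_pos hdb'] at *
  have h5 := phiFive_lt_five_mul ha1
  have h6 := phiFive_lt_five_mul hb2
  rw [neg_neg] at h6
  push_cast at *
  rw [h] at h1
  rw [hneg] at h3
  linarith

/-- If `|a|` and `|b|` are distinct prime powers and `k_5(a) = k_5(b)`, then
`gcd(5, a-1) ≠ gcd(5, b-1)` and `k_5(-a) ≠ k_5(-b)`. -/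
theorem kPart_five_eq (a b : ℤ) (ha : IsPrimePow a.natAbs) (hb : IsPrimePow b.natAbs)
    (hab : a.natAbs ≠ b.natAbs) (h : kPart 5 a = kPart 5 b) :
    Int.gcd 5 (a - 1) ≠ Int.gcd 5 (b - 1) ∧ kPart 5 (-a) ≠ kPart 5 (-b) := by
  have two_le : ∀ x : ℤ, IsPrimePow x.natAbs → 2 ≤ |x| := fun x hx => by
    have := hx.two_le
    rw [Int.abs_eq_natAbs]
    exact_mod_cast this
  have habs : |a| ≠ |b| := by
    rw [Int.abs_eq_natAbs, Int.abs_eq_natAbs]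
    exact_mod_cast hab
  have hg := gcd_ne_of_kPart_five_eq (two_le a ha) (two_le b hb) habs h
  refine ⟨hg, ?_⟩
  by_cases hda : (5 : ℤ) ∣ a - 1
  · exact kPart_five_neg_ne_of_dvd (two_le a ha) (two_le b hb) habs h hda
  · have hdb : (5 : ℤ) ∣ b - 1 := by
      by_contra hdb
      simp [gcd_five_eq, hda, hdb] at hg
    exact (kPart_five_neg_ne_of_dvd (two_le b hb) (two_le a ha) habs.symm h.symm hdb).symm
end

section
/- Let a be an odd integer with |a| > 1. Then gcd(k_8(a) − 1, k_7(a) − 1) divides 3(a + 1) if gcd(7, a − 1) = 1, and divides 75(a − 1) otherwise. -/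
theorem kPart_eq_of_coprime {i m : ℕ} {a c : ℤ} (hn : a ^ i - 1 ≠ 0)
    (hmc : (m : ℤ) * c = a ^ i - 1) (hcop : IsCoprime (m : ℤ) c)
    (hprim : ∀ r : ℕ, r.Prime → (r : ℤ) ∣ a ^ i - 1 → (eOrd r a = i ↔ r ∣ m)) :
    kPart i a = m := by
  have hnat : (a ^ i - 1).natAbs = m * c.natAbs := by
    rw [← hmc, Int.natAbs_mul, Int.natAbs_natCast]
  have hcop' : m.Coprime c.natAbs := by
    exact Int.isCoprime_iff_gcd_eq_one.mp hcop
  have hm : m ≠ 0 := by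
    rintro rfl
    apply hn
    rw [← hmc]
    simp
  have hfilter : (a ^ i - 1).natAbs.primeFactors.filter (fun r => eOrd r a = i) =
      m.primeFactors := by
    ext r
    simp only [Finset.mem_filter, Nat.mem_primeFactors]
    constructor
    · rintro ⟨⟨hr, hdvd, -⟩, he⟩
      exact ⟨hr, (hprim r hr (Int.natCast_dvd.mpr hdvd)).mp he, hm⟩
    · rintro ⟨hr, hdvd, -⟩
      have h : r ∣ (a ^ i - 1).natAbs := hnat ▸ hdvd.mul_right _
      exact ⟨⟨hr, h, Int.natAbs_ne_zero.mpr hn⟩, (hprim r hr (Int.natCast_dvd.mpr h)).mpr hdvd⟩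
  rw [kPart, hfilter, hnat]
  conv_rhs => rw [← Nat.prod_factorization_pow_eq_self hm]
  rw [Finsupp.prod, Nat.support_factorization]
  refine Finset.prod_congr rfl fun r hr => ?_
  rw [Nat.factorization_eq_of_coprime_left hcop' (by simpa using hr)]

theorem eOrd_ne_of_two_lt {a : ℤ} {i : ℕ} (hi : 2 < i) : eOrd 2 a ≠ i := by
  unfold eOrd
  split_ifs <;> omega

theorem eOrd_of_ne_two {r : ℕ} (hr : r ≠ 2) (a : ℤ) : eOrd r a = orderOf (a : ZMod r) :=
  if_neg hr

theorem pow_sub_one_ne_zero {a : ℤ} (ha : 1 < a.natAbs) {i : ℕ} (hi : i ≠ 0) :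
    a ^ i - 1 ≠ 0 := by
  intro h
  have h1 : a.natAbs ^ i = 1 := by
    rw [← Int.natAbs_pow, sub_eq_zero.mp h]
    rfl
  rcases Nat.pow_eq_one.mp h1 with h2 | h2 <;> omega

theorem two_mul_kPart_eight {a : ℤ} (ha : 1 < a.natAbs) (hodd : Odd a) :
    2 * (kPart 8 a : ℤ) = a ^ 4 + 1 := by
  obtain ⟨k, rfl⟩ := hodd
  set a : ℤ := 2 * k + 1 with hak
  set s : ℤ := 4 * k ^ 4 + 8 * k ^ 3 + 6 * k ^ 2 + 2 * k with hs
  have hs0 : 0 ≤ 2 * s + 1 := by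
    have : 2 * (2 * s + 1) = a ^ 4 + 1 := by rw [hs, hak]; ring
    have : 0 ≤ a ^ 4 := by positivity
    omega
  obtain ⟨m, hm⟩ := Int.eq_ofNat_of_zero_le hs0
  have hma : 2 * (m : ℤ) = a ^ 4 + 1 := by rw [← hm, hs, hak]; ring
  rw [kPart_eq_of_coprime (m := m) (c := 2 * (a ^ 4 - 1)) (pow_sub_one_ne_zero ha (by norm_num))]
  · exact hma
  · linear_combination (a ^ 4 - 1) * hma
  · have h2 : IsCoprime (m : ℤ) 2 := ⟨1, -s, by rw [← hm]; ring⟩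
    refine h2.mul_right ?_
    have h4 : a ^ 4 - 1 = -2 + (m : ℤ) * 2 := by linear_combination -hma
    rw [h4]
    exact h2.neg_right.add_mul_left_right 2
  · intro r hr hdvd
    have : Fact r.Prime := ⟨hr⟩
    by_cases hr2 : r = 2
    · subst hr2
      refine iff_of_false (eOrd_ne_of_two_lt (by norm_num)) fun h => ?_
      have : (2 : ℤ) ∣ m := by exact_mod_cast h
      omega
    have h2 : (2 : ZMod r) ≠ 0 := by
      intro h
      have h' : ((2 : ℕ) : ZMod r) = 0 := by exact_mod_cast h
      exact hr2 ((Nat.prime_dvd_prime_iff_eq hr Nat.prime_two).mp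
        ((ZMod.natCast_eq_zero_iff 2 r).mp h'))
    have hz : 2 * (m : ZMod r) = (a : ZMod r) ^ 4 + 1 := by
      exact_mod_cast congrArg (Int.cast : ℤ → ZMod r) hma
    rw [eOrd_of_ne_two hr2, ← ZMod.natCast_eq_zero_iff]
    constructor
    · intro ho
      have h8 : (a : ZMod r) ^ 8 = 1 := ho ▸ pow_orderOf_eq_one (a : ZMod r)
      have h4 : (a : ZMod r) ^ 4 ≠ 1 :=
        pow_ne_one_of_lt_orderOf (by norm_num) (by rw [ho]; norm_num)
      have hmul : ((a : ZMod r) ^ 4 - 1) * (2 * (m : ZMod r)) = 0 := by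
        rw [hz]
        linear_combination h8
      simpa [sub_eq_zero, h4, h2] using hmul
    · intro hm0
      have h4 : (a : ZMod r) ^ 4 = -1 := by linear_combination -hz + 2 * hm0
      refine orderOf_eq_prime_pow (p := 2) (n := 2) (x := (a : ZMod r)) ?_ ?_
      · norm_num
        rw [h4]
        intro h
        exact h2 (by linear_combination -h)
      · norm_num
        linear_combination ((a : ZMod r) ^ 4 - 1) * h4

theorem kPart_seven_eq {a d : ℤ} {m : ℕ} (ha : 1 < a.natAbs) (hodd : Odd a)
    (hm : d * m = a ^ 6 + a ^ 5 + a ^ 4 + a ^ 3 + a ^ 2 + a + 1)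
    (hd : d ∣ a - 1) (hcop : IsCoprime (m : ℤ) (a - 1)) : kPart 7 a = m := by
  apply kPart_eq_of_coprime (c := d * (a - 1)) (pow_sub_one_ne_zero ha (by norm_num))
  · linear_combination (a - 1) * hm
  · exact (hcop.of_isCoprime_of_dvd_right hd).mul_right hcop
  · intro r hr hdvd
    have : Fact r.Prime := ⟨hr⟩
    have hunit : r ∣ m → ¬ (r : ℤ) ∣ a - 1 := fun h h' =>
      (Nat.prime_iff_prime_int.mp hr).not_isUnit
        (hcop.isUnit_of_dvd' (Int.natCast_dvd_natCast.mpr h) h')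
    by_cases hr2 : r = 2
    · subst hr2
      refine iff_of_false (eOrd_ne_of_two_lt (by norm_num)) fun h => hunit h ?_
      obtain ⟨k, rfl⟩ := hodd
      exact ⟨k, by push_cast; ring⟩
    have hz : (a : ZMod r) ^ 7 - 1 = ((a : ZMod r) - 1) * ((d : ZMod r) * m) := by
      have h : a ^ 7 - 1 = (a - 1) * (d * m) := by rw [hm]; ring
      exact_mod_cast congrArg (Int.cast : ℤ → ZMod r) h
    have hone : (a : ZMod r) = 1 ↔ (r : ℤ) ∣ a - 1 := by
      rw [← ZMod.intCast_zmod_eq_zero_iff_dvd]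
      push_cast
      exact sub_eq_zero.symm
    rw [eOrd_of_ne_two hr2]
    constructor
    · intro ho
      have h7 : (a : ZMod r) ^ 7 = 1 := ho ▸ pow_orderOf_eq_one (a : ZMod r)
      have h1 : (a : ZMod r) ≠ 1 := by
        intro h
        rw [h, orderOf_one] at ho
        norm_num at ho
      have hd0 : (d : ZMod r) ≠ 0 := fun h =>
        h1 (hone.mpr (((ZMod.intCast_zmod_eq_zero_iff_dvd d r).mp h).trans hd))
      rw [h7, sub_self] at hz
      rw [← ZMod.natCast_eq_zero_iff]
      simpa [sub_eq_zero, h1, hd0] using hz.symm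
    · intro h
      have : Fact (Nat.Prime 7) := ⟨by norm_num⟩
      refine orderOf_eq_prime ?_ fun h1 => hunit h (hone.mp h1)
      rw [(ZMod.natCast_eq_zero_iff m r).mpr h] at hz
      linear_combination hz

theorem seven_mul_kPart_seven {a : ℤ} (ha : 1 < a.natAbs) (hodd : Odd a) (h7 : 7 ∣ a - 1) :
    7 * (kPart 7 a : ℤ) = a ^ 6 + a ^ 5 + a ^ 4 + a ^ 3 + a ^ 2 + a + 1 := by
  obtain ⟨t, ht⟩ := h7
  obtain rfl : a = 7 * t + 1 := by linarith
  set a : ℤ := 7 * t + 1 with hat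
  set u : ℤ := a ^ 5 + 2 * a ^ 4 + 3 * a ^ 3 + 4 * a ^ 2 + 5 * a + 6 with hu
  have hsum : 7 * (t * u + 1) = a ^ 6 + a ^ 5 + a ^ 4 + a ^ 3 + a ^ 2 + a + 1 := by
    rw [hu]
    linear_combination -(a ^ 5 + 2 * a ^ 4 + 3 * a ^ 3 + 4 * a ^ 2 + 5 * a + 6) * ht
  have hpos : 0 ≤ t * u + 1 := by
    have : 0 ≤ a ^ 6 + a ^ 5 + a ^ 4 + a ^ 3 + a ^ 2 + a + 1 := by
      nlinarith [sq_nonneg (a ^ 3 + a ^ 2), sq_nonneg (a ^ 2 + a), sq_nonneg (a + 1),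
        sq_nonneg (a ^ 3)]
    linarith
  obtain ⟨m, hm⟩ := Int.eq_ofNat_of_zero_le hpos
  rw [kPart_seven_eq (d := 7) (m := m) ha hodd, ← hm, hsum]
  · rw [← hm, hsum]
  · exact ⟨t, ht⟩
  · obtain ⟨v, hv⟩ : (7 : ℤ) ∣ u := by
      refine ⟨(7 * t) ^ 4 * t + 7 * (7 * t) ^ 3 * t + 21 * (7 * t) ^ 2 * t + 35 * (7 * t) * t
        + 35 * t + 3, ?_⟩
      rw [hu, hat]
      ring
    refine ⟨1, -v, ?_⟩
    rw [← hm, ht, hv]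
    ring

theorem kPart_seven_of_coprime {a : ℤ} (ha : 1 < a.natAbs) (hodd : Odd a)
    (h7 : IsCoprime 7 (a - 1)) :
    (kPart 7 a : ℤ) = a ^ 6 + a ^ 5 + a ^ 4 + a ^ 3 + a ^ 2 + a + 1 := by
  have hpos : 0 ≤ a ^ 6 + a ^ 5 + a ^ 4 + a ^ 3 + a ^ 2 + a + 1 := by
    nlinarith [sq_nonneg (a ^ 3 + a ^ 2), sq_nonneg (a ^ 2 + a), sq_nonneg (a + 1),
      sq_nonneg (a ^ 3)]
  obtain ⟨m, hm⟩ := Int.eq_ofNat_of_zero_le hpos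
  rw [kPart_seven_eq (d := 1) (m := m) ha hodd, hm]
  · rw [← hm, one_mul]
  · exact one_dvd _
  · have h : (m : ℤ) = 7 + (a - 1) * (a ^ 5 + 2 * a ^ 4 + 3 * a ^ 3 + 4 * a ^ 2 + 5 * a + 6) := by
      rw [← hm]
      ring
    rw [h]
    exact h7.add_mul_left_left _

/-- `gcd(k_8(a)-1, k_7(a)-1)` divides `3(a+1)` if `gcd(7, a-1) = 1`,
and divides `75(a-1)` otherwise. -/
theorem gcd_k8_k7 (a : ℤ) (ha : 1 < a.natAbs) (hodd : Odd a) :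
    (Int.gcd 7 (a - 1) = 1 →
      (Int.gcd ((kPart 8 a : ℤ) - 1) ((kPart 7 a : ℤ) - 1) : ℤ) ∣ 3 * (a + 1)) ∧
    (Int.gcd 7 (a - 1) ≠ 1 →
      (Int.gcd ((kPart 8 a : ℤ) - 1) ((kPart 7 a : ℤ) - 1) : ℤ) ∣ 75 * (a - 1)) := by
  have h8 := two_mul_kPart_eight ha hodd
  obtain ⟨x, hx⟩ := Int.gcd_dvd_left ((kPart 8 a : ℤ) - 1) ((kPart 7 a : ℤ) - 1)
  obtain ⟨y, hy⟩ := Int.gcd_dvd_right ((kPart 8 a : ℤ) - 1) ((kPart 7 a : ℤ) - 1)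
  generalize (Int.gcd ((kPart 8 a : ℤ) - 1) ((kPart 7 a : ℤ) - 1) : ℤ) = g at hx hy ⊢
  have hP : a ^ 4 - 1 = g * (2 * x) := by linear_combination 2 * hx - h8
  constructor
  · intro h
    have h7 := kPart_seven_of_coprime ha hodd (Int.isCoprime_iff_gcd_eq_one.mpr h)
    have hB : a ^ 6 + a ^ 5 + a ^ 4 + a ^ 3 + a ^ 2 + a = g * y := by
      linear_combination hy - h7
    refine ⟨(2 * a ^ 2 - 3 * a + 2) * (y - (a ^ 2 + a + 1) * (2 * x)) - (2 * a + 1) * (2 * x), ?_⟩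
    linear_combination (2 * a ^ 2 - 3 * a + 2) * (hB - (a ^ 2 + a + 1) * hP) - (2 * a + 1) * hP
  · intro h
    have hdvd : (7 : ℤ) ∣ a - 1 := by
      by_contra hnd
      exact h (Int.isCoprime_iff_gcd_eq_one.mp
        (((Nat.prime_iff_prime_int.mp (by norm_num : Nat.Prime 7)).coprime_iff_not_dvd).mpr hnd))
    have h7 := seven_mul_kPart_seven ha hodd hdvd
    have hF : a ^ 6 + a ^ 5 + a ^ 4 + a ^ 3 + a ^ 2 + a + 1 - 7 = g * (7 * y) := by
      linear_combination 7 * hy - h7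
    refine ⟨(5 - 2 * a) * (2 * x - (a - 2) * (7 * y - (a ^ 2 + a + 1) * (2 * x)))
      + 4 * (7 * y - (a ^ 2 + a + 1) * (2 * x)), ?_⟩
    linear_combination (5 - 2 * a) * (hP - (a - 2) * (hF - (a ^ 2 + a + 1) * hP))
      + 4 * (hF - (a ^ 2 + a + 1) * hP)
end

section
/- Let a be an even integer with |a| > 1. Then gcd(7·k_8(a) − 1, Φ_5(a)) divides 31·61, gcd(7·k_8(a) − 1, Φ_3(a)) divides 43, and gcd(7·k_8(a) − 1, Φ_4(a)) divides 13. -/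
/-- For even `a`, the numbers `a ^ 4 + 1` and `a ^ 4 - 1` are coprime. -/
lemma coprime_pow_four_add_one_sub_one {a : ℤ} (heven : Even a) :
    (a ^ 4 + 1).natAbs.Coprime (a ^ 4 - 1).natAbs := by
  obtain ⟨b, rfl⟩ := heven
  rw [← Int.isCoprime_iff_nat_coprime]
  exact ⟨1 - 8 * b ^ 4, 8 * b ^ 4, by ring⟩

/-- For even `a`, a prime dividing `a ^ 8 - 1` is primitive exactly when it divides `a ^ 4 + 1`. -/
lemma eOrd_eq_eight_iff {a : ℤ} (heven : Even a) {r : ℕ} (hr : r.Prime)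
    (hdvd : r ∣ (a ^ 8 - 1).natAbs) : eOrd r a = 8 ↔ r ∣ (a ^ 4 + 1).natAbs := by
  have := Fact.mk hr
  rw [← Int.natCast_dvd] at hdvd ⊢
  have hr2 : r ≠ 2 := by
    rintro rfl
    have h : Even (a ^ 8) := heven.pow_of_ne_zero (by norm_num)
    rw [even_iff_two_dvd] at h
    push_cast at hdvd
    omega
  have h2 : (2 : ZMod r) ≠ 0 := fun h ↦ hr2 <|
    (Nat.prime_dvd_prime_iff_eq hr Nat.prime_two).1 <|
      (ZMod.natCast_eq_zero_iff 2 r).1 (by exact_mod_cast h)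
  rw [← ZMod.intCast_zmod_eq_zero_iff_dvd] at hdvd ⊢
  push_cast at hdvd ⊢
  rw [eOrd, if_neg hr2]
  constructor
  · intro h
    have hne : (a : ZMod r) ^ 4 ≠ 1 := pow_ne_one_of_lt_orderOf (by norm_num) (by omega)
    have hmul : ((a : ZMod r) ^ 4 - 1) * ((a : ZMod r) ^ 4 + 1) = 0 := by
      linear_combination hdvd
    exact (mul_eq_zero.1 hmul).resolve_left (sub_ne_zero.2 hne)
  · intro h
    refine orderOf_eq_prime_pow (p := 2) (n := 2) (fun h1 ↦ h2 ?_) ?_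
    · norm_num at h1
      linear_combination h - h1
    · norm_num
      linear_combination hdvd

/-- For even `a`, the primitive part of `a ^ 8 - 1` is `a ^ 4 + 1`. -/
lemma kPart_eight_of_even {a : ℤ} (ha : 1 < a.natAbs) (heven : Even a) :
    (kPart 8 a : ℤ) = a ^ 4 + 1 := by
  have hcop := coprime_pow_four_add_one_sub_one heven
  have hmul : (a ^ 8 - 1).natAbs = (a ^ 4 + 1).natAbs * (a ^ 4 - 1).natAbs := by
    rw [← Int.natAbs_mul]
    congr 1
    ring
  have hpos : 0 < a ^ 4 + 1 := by positivity
  have hm : (a ^ 4 + 1).natAbs ≠ 0 := Int.natAbs_ne_zero.2 hpos.ne'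
  have hl : (a ^ 4 - 1).natAbs ≠ 0 := by
    rw [Int.natAbs_ne_zero, sub_ne_zero]
    intro h
    have h1 := congrArg Int.natAbs h
    rw [Int.natAbs_pow] at h1
    exact (Nat.one_lt_pow (by norm_num) ha).ne' h1
  have hset : (a ^ 8 - 1).natAbs.primeFactors.filter (fun r ↦ eOrd r a = 8) =
      (a ^ 4 + 1).natAbs.primeFactors := by
    ext r
    simp only [Finset.mem_filter, Nat.mem_primeFactors]
    constructor
    · rintro ⟨⟨hr, hd, -⟩, h⟩
      exact ⟨hr, (eOrd_eq_eight_iff heven hr hd).1 h, hm⟩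
    · rintro ⟨hr, hd, -⟩
      have hd8 : r ∣ (a ^ 8 - 1).natAbs := hmul ▸ hd.mul_right _
      exact ⟨⟨hr, hd8, hmul ▸ mul_ne_zero hm hl⟩, (eOrd_eq_eight_iff heven hr hd8).2 hd⟩
  have hk : kPart 8 a = (a ^ 4 + 1).natAbs := by
    rw [kPart, hset]
    conv_rhs => rw [← Nat.prod_factorization_pow_eq_self hm,
      Nat.prod_factorization_eq_prod_primeFactors]
    refine Finset.prod_congr rfl fun r hr ↦ ?_
    rw [hmul, Nat.factorization_eq_of_coprime_left hcop (by simpa using hr)]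
  rw [hk, Int.natAbs_of_nonneg hpos.le]

/-- For even `a` with `|a| > 1`: `gcd(7k_8(a)-1, Φ_5(a))` divides `31·61`,
`gcd(7k_8(a)-1, Φ_3(a))` divides `43` and `gcd(7k_8(a)-1, Φ_4(a))` divides `13`. -/
theorem gcd_seven_k8_even (a : ℤ) (ha : 1 < a.natAbs) (heven : Even a) :
    Int.gcd (7 * (kPart 8 a : ℤ) - 1) ((Polynomial.cyclotomic 5 ℤ).eval a) ∣ 31 * 61 ∧
    Int.gcd (7 * (kPart 8 a : ℤ) - 1) ((Polynomial.cyclotomic 3 ℤ).eval a) ∣ 43 ∧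
    Int.gcd (7 * (kPart 8 a : ℤ) - 1) ((Polynomial.cyclotomic 4 ℤ).eval a) ∣ 13 := by
  rw [kPart_eight_of_even ha heven]
  have h3 : (Polynomial.cyclotomic 3 ℤ).eval a = a ^ 2 + a + 1 := by
    simp [Polynomial.cyclotomic_three]
  have h4 : (Polynomial.cyclotomic 4 ℤ).eval a = a ^ 2 + 1 := by
    rw [show 4 = 2 ^ (1 + 1) by norm_num, Polynomial.cyclotomic_prime_pow_eq_geom_sum Nat.prime_two]
    simp [Finset.sum_range_succ, add_comm]
  have h5 : (Polynomial.cyclotomic 5 ℤ).eval a = a ^ 4 + a ^ 3 + a ^ 2 + a + 1 := by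
    have := Fact.mk Nat.prime_five
    rw [Polynomial.cyclotomic_prime]
    simp only [Finset.sum_range_succ, Finset.sum_range_zero, Polynomial.eval_add,
      Polynomial.eval_pow, Polynomial.eval_X, Polynomial.eval_zero]
    ring
  have key (x y u v : ℤ) (n : ℕ) (h : (n : ℤ) = x * u + y * v) : Int.gcd x y ∣ n :=
    Int.gcd_dvd_iff.2 ⟨u, v, h⟩
  rw [h3, h4, h5]
  refine ⟨key _ _ (-(216 * a ^ 3 - 36 * a ^ 2 + 258 * a - 85) * a)
    (1296 + 7 * (a - 1) * (216 * a ^ 3 - 36 * a ^ 2 + 258 * a - 85)) _ ?_,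
    key _ _ (-(7 * a + 1)) (49 + 7 * a * (a - 1) * (7 * a + 1)) _ ?_,
    key _ _ 1 (-7 * (a ^ 2 - 1)) _ ?_⟩ <;> push_cast <;> ring
end
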